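/- Let G = (V,E) be a finite graph with coupling constants J : E → ℝ≥0 and β > 0, and let w, ∂ and Z be the associated random-current weight, source map and partition functions. Then for every B ⊆ V and all pairwise distinct edges e_1, …, e_k, f_1, …, f_l ∈ E, one has ∑_{n : ∂n = B, n_{e_i} ≥ 1 for all i, n_{f_j} = 0 for all j} w(n) ≤ 2^l β^k (∏_{i=1}^k J_{e_i}) (∏_{j=1}^l e^{−βJ_{f_j}}) · Z(B Δ e_1 Δ ⋯ Δ e_k). -/

import Mathlib

open scoped BigOperators

noncomputable section

variable {V E : Type} [Fintype V] [Fintype E] [DecidableEq V] [DecidableEq E]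

/-- The degree `∑_{e ∋ x} n_e` of a vertex `x` in a current `n` on the finite
(multi)graph with edge-endpoint maps `g1, g2`. -/
def curDeg (g1 g2 : E → V) (n : E → ℕ) (x : V) : ℕ :=
  ∑ e : E, if x = g1 e ∨ x = g2 e then n e else 0

/-- The source set `∂n = {x ∈ V : ∑_{e ∋ x} n_e is odd}` of a current `n`. -/
def curSources (g1 g2 : E → V) (n : E → ℕ) : Finset V :=
  Finset.univ.filter fun x => Odd (curDeg g1 g2 n x)

/-- The random-current weight `w(n) = ∏_{e∈E} (βJ_e)^{n_e}/n_e!`. -/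
def curWeight (β : ℝ) (J : E → ℝ) (n : E → ℕ) : ℝ :=
  ∏ e : E, (β * J e) ^ n e / (Nat.factorial (n e) : ℝ)

/-- The random-current partition function `Z(F) = ∑_{n : ∂n = F} w(n)`. -/
def curZ (g1 g2 : E → V) (β : ℝ) (J : E → ℝ) (F : Finset V) : ℝ :=
  ∑' n : E → ℕ, if curSources g1 g2 n = F then curWeight β J n else 0

open Finset

lemma curDeg_add_single (g1 g2 : E → V) (n : E → ℕ) (e : E) (c : ℕ) (x : V) :
    curDeg g1 g2 (n + Pi.single e c) x =
      curDeg g1 g2 n x + if x = g1 e ∨ x = g2 e then c else 0 := by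
  have h : ∀ a, (if x = g1 a ∨ x = g2 a then (n + Pi.single e c : E → ℕ) a else 0) =
      (if x = g1 a ∨ x = g2 a then n a else 0) +
        if a = e then (if x = g1 e ∨ x = g2 e then c else 0) else 0 := by
    intro a
    by_cases ha : a = e
    · subst ha
      by_cases hx : x = g1 a ∨ x = g2 a <;> simp [hx]
    · simp [ha]
  simp only [curDeg, h, sum_add_distrib, sum_ite_eq', mem_univ, if_true]

lemma curSources_add_single_one (g1 g2 : E → V) (n : E → ℕ) (e : E) :
    curSources g1 g2 (n + Pi.single e 1) = symmDiff (curSources g1 g2 n) {g1 e, g2 e} := by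
  ext x
  by_cases hx : x = g1 e ∨ x = g2 e <;>
    simp [curSources, curDeg_add_single, mem_symmDiff, hx, Nat.odd_add_one]

lemma curSources_add_single_even (g1 g2 : E → V) (n : E → ℕ) (e : E) {c : ℕ} (hc : Even c) :
    curSources g1 g2 (n + Pi.single e c) = curSources g1 g2 n := by
  ext x
  by_cases hx : x = g1 e ∨ x = g2 e <;>
    simp [curSources, curDeg_add_single, hx, Nat.odd_add, hc]

lemma curWeight_nonneg {β : ℝ} (hβ : 0 ≤ β) {J : E → ℝ} (hJ : ∀ e, 0 ≤ J e) (n : E → ℕ) :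
    0 ≤ curWeight β J n :=
  prod_nonneg fun e _ => div_nonneg (pow_nonneg (mul_nonneg hβ (hJ e)) _) (Nat.cast_nonneg _)

lemma curWeight_add_single_one_le {β : ℝ} (hβ : 0 ≤ β) {J : E → ℝ} (hJ : ∀ e, 0 ≤ J e)
    (n : E → ℕ) (e : E) :
    curWeight β J (n + Pi.single e 1) ≤ β * J e * curWeight β J n := by
  have ht : ∀ a, 0 ≤ β * J a := fun a => mul_nonneg hβ (hJ a)
  unfold curWeight
  rw [← mul_prod_erase univ _ (mem_univ e),
    ← mul_prod_erase univ (fun a => (β * J a) ^ n a / _) (mem_univ e), ← mul_assoc]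
  have hrest : ∏ a ∈ univ.erase e,
      (β * J a) ^ (n + Pi.single e 1 : E → ℕ) a / (Nat.factorial ((n + Pi.single e 1 : E → ℕ) a) : ℝ) =
        ∏ a ∈ univ.erase e, (β * J a) ^ n a / (Nat.factorial (n a) : ℝ) := by
    refine prod_congr rfl fun a ha => ?_
    simp [ne_of_mem_erase ha]
  rw [hrest]
  refine mul_le_mul_of_nonneg_right ?_
    (prod_nonneg fun a _ => div_nonneg (pow_nonneg (ht a) _) (Nat.cast_nonneg _))
  rw [Pi.add_apply, Pi.single_eq_same, ← mul_div_assoc, ← pow_succ']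
  refine div_le_div_of_nonneg_left (pow_nonneg (ht e) _) (by positivity) ?_
  exact_mod_cast Nat.factorial_le (Nat.le_succ _)

lemma curWeight_add_single_of_eq_zero (β : ℝ) (J : E → ℝ) {n : E → ℕ} {e : E} (hn : n e = 0)
    (c : ℕ) :
    curWeight β J (n + Pi.single e c) =
      curWeight β J n * ((β * J e) ^ c / (Nat.factorial c : ℝ)) := by
  unfold curWeight
  rw [← mul_prod_erase univ _ (mem_univ e),
    ← mul_prod_erase univ (fun a => (β * J a) ^ n a / _) (mem_univ e)]
  have hrest : ∏ a ∈ univ.erase e,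
      (β * J a) ^ (n + Pi.single e c : E → ℕ) a / (Nat.factorial ((n + Pi.single e c : E → ℕ) a) : ℝ) =
        ∏ a ∈ univ.erase e, (β * J a) ^ n a / (Nat.factorial (n a) : ℝ) := by
    refine prod_congr rfl fun a ha => ?_
    simp [ne_of_mem_erase ha]
  rw [hrest]
  simp [hn, mul_comm]

lemma summable_curWeight {β : ℝ} (hβ : 0 ≤ β) {J : E → ℝ} (hJ : ∀ e, 0 ≤ J e) :
    Summable (curWeight β J) := by
  have ht : ∀ a (m : ℕ), 0 ≤ (β * J a) ^ m / (Nat.factorial m : ℝ) := fun a m =>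
    div_nonneg (pow_nonneg (mul_nonneg hβ (hJ a)) _) (Nat.cast_nonneg _)
  refine summable_of_sum_le (c := ∏ e, ∑' m : ℕ, (β * J e) ^ m / (Nat.factorial m : ℝ))
    (curWeight_nonneg hβ hJ) fun u => ?_
  calc ∑ n ∈ u, curWeight β J n
      ≤ ∑ n ∈ Fintype.piFinset fun e => u.image fun n => n e, curWeight β J n := by
        refine sum_le_sum_of_subset_of_nonneg (fun n hn => ?_)
          fun n _ _ => curWeight_nonneg hβ hJ n
        exact Fintype.mem_piFinset.2 fun e => mem_image_of_mem _ hn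
    _ = ∏ e, ∑ m ∈ u.image fun n => n e, (β * J e) ^ m / (Nat.factorial m : ℝ) := by
        rw [prod_univ_sum]
        rfl
    _ ≤ _ := prod_le_prod (fun e _ => sum_nonneg fun m _ => ht e m) fun e _ =>
        (Real.summable_pow_div_factorial _).sum_le_tsum _ fun m _ => ht e m

lemma summable_ite_curWeight {β : ℝ} (hβ : 0 ≤ β) {J : E → ℝ} (hJ : ∀ e, 0 ≤ J e)
    (P : (E → ℕ) → Prop) [DecidablePred P] :
    Summable fun n => if P n then curWeight β J n else 0 := by
  refine (summable_curWeight hβ hJ).of_nonneg_of_le (fun n => ?_) fun n => ?_ <;>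
    split_ifs <;> simp [curWeight_nonneg hβ hJ]

/-- Deleting one unit of current from `e`: currents with `n e ≥ 1` and sources `B` are compared
with currents with sources `B Δ e`. -/
lemma tsum_curWeight_one_le_le (g1 g2 : E → V) {β : ℝ} (hβ : 0 ≤ β) {J : E → ℝ}
    (hJ : ∀ e, 0 ≤ J e) (B : Finset V) (e : E) (P : (E → ℕ) → Prop) [DecidablePred P]
    (hP : ∀ n c, P (n + Pi.single e c) ↔ P n) :
    (∑' n : E → ℕ, if curSources g1 g2 n = B ∧ 1 ≤ n e ∧ P n then curWeight β J n else 0) ≤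
      β * J e * ∑' n : E → ℕ,
        if curSources g1 g2 n = symmDiff B {g1 e, g2 e} ∧ P n then curWeight β J n else 0 := by
  have hinj : Function.Injective fun n : E → ℕ => n + Pi.single e 1 := add_left_injective _
  set F : (E → ℕ) → ℝ := fun n =>
    if curSources g1 g2 n = B ∧ 1 ≤ n e ∧ P n then curWeight β J n else 0 with hF
  have hFs : Summable F := summable_ite_curWeight hβ hJ _
  have hsupp : Function.support F ⊆ Set.range fun n : E → ℕ => n + Pi.single e 1 := by
    intro n hn
    have h1 : 1 ≤ n e := by
      by_contra h
      simp [hF, h] at hn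
    refine ⟨n - Pi.single e 1, funext fun a => ?_⟩
    by_cases ha : a = e
    · subst ha
      simp [h1]
    · simp [ha]
  rw [← hinj.tsum_eq hsupp, ← tsum_mul_left]
  refine Summable.tsum_le_tsum (fun n => ?_) (hFs.comp_injective hinj)
    ((summable_ite_curWeight hβ hJ _).mul_left _)
  have hs : curSources g1 g2 (n + Pi.single e 1) = B ↔
      curSources g1 g2 n = symmDiff B {g1 e, g2 e} := by
    rw [curSources_add_single_one]
    constructor <;> intro h
    · rw [← h, symmDiff_symmDiff_cancel_right]
    · rw [h, symmDiff_symmDiff_cancel_right]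
  simp only [hF, hs, hP, Pi.add_apply, Pi.single_eq_same, Nat.le_add_left, true_and]
  split_ifs
  · exact curWeight_add_single_one_le hβ hJ n e
  · simp

/-- Opening an edge `e` that carries no current: summing over the even values of the current on
`e` gains a factor `cosh (β J_e) ≥ exp (β J_e) / 2`. -/
lemma tsum_curWeight_eq_zero_le (g1 g2 : E → V) {β : ℝ} (hβ : 0 ≤ β) {J : E → ℝ}
    (hJ : ∀ e, 0 ≤ J e) (B : Finset V) (e : E) (P : (E → ℕ) → Prop) [DecidablePred P]
    (hP : ∀ n c, P (n + Pi.single e c) ↔ P n) :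
    (∑' n : E → ℕ, if curSources g1 g2 n = B ∧ n e = 0 ∧ P n then curWeight β J n else 0) ≤
      2 * Real.exp (-(β * J e)) * ∑' n : E → ℕ,
        if curSources g1 g2 n = B ∧ P n then curWeight β J n else 0 := by
  set F : (E → ℕ) → ℝ := fun n =>
    if curSources g1 g2 n = B ∧ n e = 0 ∧ P n then curWeight β J n else 0 with hF
  set G : (E → ℕ) → ℝ := fun n =>
    if curSources g1 g2 n = B ∧ P n then curWeight β J n else 0 with hG
  have hF0 : ∀ n, 0 ≤ F n := fun n => by
    simp only [hF]; split_ifs <;> simp [curWeight_nonneg hβ hJ]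
  have hG0 : ∀ n, 0 ≤ G n := fun n => by
    simp only [hG]; split_ifs <;> simp [curWeight_nonneg hβ hJ]
  have hFs : Summable F := summable_ite_curWeight hβ hJ _
  have hGs : Summable G := summable_ite_curWeight hβ hJ _
  have hcosh := Real.hasSum_cosh (β * J e)
  have hc0 : ∀ m : ℕ, 0 ≤ (β * J e) ^ (2 * m) / (Nat.factorial (2 * m) : ℝ) := fun m =>
    div_nonneg (pow_nonneg (mul_nonneg hβ (hJ e)) _) (Nat.cast_nonneg _)
  have hsub : ∑' n : {n : E → ℕ // n e = 0}, F n = ∑' n, F n := by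
    refine Subtype.val_injective.tsum_eq fun n hn => ?_
    by_contra h
    have h0 : ¬ n e = 0 := fun h0 => h ⟨⟨n, h0⟩, rfl⟩
    simp [hF, h0] at hn
  have hF's : Summable fun n : {n : E → ℕ // n e = 0} => F n :=
    hFs.comp_injective Subtype.val_injective
  have hprod : Summable fun p : {n : E → ℕ // n e = 0} × ℕ =>
      F p.1 * ((β * J e) ^ (2 * p.2) / (Nat.factorial (2 * p.2) : ℝ)) :=
    hF's.mul_of_nonneg hcosh.summable (fun n => hF0 n) hc0
  have hφ : Function.Injective fun p : {n : E → ℕ // n e = 0} × ℕ =>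
      p.1.1 + Pi.single e (2 * p.2) := by
    rintro ⟨⟨n, hn⟩, m⟩ ⟨⟨n', hn'⟩, m'⟩ h
    have hm : m = m' := by
      have := congrFun h e
      simp [hn, hn'] at this
      exact this
    subst hm
    have hnn : n = n' := add_left_injective _ h
    subst hnn
    rfl
  have key : (∑' n, F n) * Real.cosh (β * J e) ≤ ∑' n, G n := by
    rw [← hsub, ← hcosh.tsum_eq, hF's.tsum_mul_tsum hcosh.summable hprod]
    refine Summable.tsum_le_tsum_of_inj _ hφ (fun n _ => hG0 n) ?_ hprod hGs
    rintro ⟨⟨n, hn⟩, m⟩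
    simp only [hF, hG, hn, curSources_add_single_even g1 g2 n e (even_two_mul m), hP,
      curWeight_add_single_of_eq_zero β J hn, true_and]
    split_ifs <;> simp
  have hexp : 1 ≤ 2 * Real.exp (-(β * J e)) * Real.cosh (β * J e) := by
    have h1 : Real.exp (-(β * J e)) * Real.exp (β * J e) = 1 := by
      rw [← Real.exp_add]; simp
    rw [Real.cosh_eq]
    nlinarith [Real.exp_pos (-(β * J e))]
  calc ∑' n, F n ≤ (∑' n, F n) * (2 * Real.exp (-(β * J e)) * Real.cosh (β * J e)) :=
        le_mul_of_one_le_right (tsum_nonneg hF0) hexp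
    _ = 2 * Real.exp (-(β * J e)) * ((∑' n, F n) * Real.cosh (β * J e)) := by ring
    _ ≤ _ := mul_le_mul_of_nonneg_left key (by positivity)

lemma tsum_curWeight_forall_eq_zero_le (g1 g2 : E → V) {β : ℝ} (hβ : 0 ≤ β) {J : E → ℝ}
    (hJ : ∀ e, 0 ≤ J e) (B : Finset V) {l : ℕ} (fs : Fin l → E)
    (hfs : Function.Injective fs) :
    (∑' n : E → ℕ,
        if curSources g1 g2 n = B ∧ ∀ j, n (fs j) = 0 then curWeight β J n else 0) ≤
      2 ^ l * (∏ j, Real.exp (-(β * J (fs j)))) * curZ g1 g2 β J B := by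
  induction l with
  | zero => simp [curZ]
  | succ l ih =>
    have hstep := tsum_curWeight_eq_zero_le g1 g2 hβ hJ B (fs 0)
      (fun n => ∀ j : Fin l, n (fs j.succ) = 0) fun n c => by
        refine forall_congr' fun j => ?_
        simp [hfs.ne (Fin.succ_ne_zero j)]
    simp only [Fin.forall_fin_succ, Fin.prod_univ_succ]
    refine hstep.trans ((mul_le_mul_of_nonneg_left
      (ih (fun j => fs j.succ) (hfs.comp (Fin.succ_injective l))) (by positivity)).trans_eq ?_)
    ring

lemma tsum_curWeight_forall_one_le_le (g1 g2 : E → V) {β : ℝ} (hβ : 0 ≤ β) {J : E → ℝ}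
    (hJ : ∀ e, 0 ≤ J e) (B : Finset V) {k : ℕ} (es : Fin k → E)
    (hes : Function.Injective es) (P : (E → ℕ) → Prop) [DecidablePred P]
    (hP : ∀ i n c, P (n + Pi.single (es i) c) ↔ P n) :
    (∑' n : E → ℕ,
        if curSources g1 g2 n = B ∧ (∀ i, 1 ≤ n (es i)) ∧ P n then curWeight β J n else 0) ≤
      β ^ k * (∏ i, J (es i)) * ∑' n : E → ℕ,
        if curSources g1 g2 n = (List.finRange k).foldl
          (fun F i => symmDiff F {g1 (es i), g2 (es i)}) B ∧ P n then curWeight β J n else 0 := by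
  induction k generalizing B with
  | zero => simp
  | succ k ih =>
    have hstep := tsum_curWeight_one_le_le g1 g2 hβ hJ B (es 0)
      (fun n => (∀ i : Fin k, 1 ≤ n (es i.succ)) ∧ P n) fun n c => by
        refine and_congr (forall_congr' fun i => ?_) (hP 0 n c)
        simp [hes.ne (Fin.succ_ne_zero i)]
    simp only [Fin.forall_fin_succ, Fin.prod_univ_succ, and_assoc, List.finRange_succ,
      List.foldl_cons, List.foldl_map]
    refine hstep.trans ((mul_le_mul_of_nonneg_left
      (ih (symmDiff B {g1 (es 0), g2 (es 0)}) (fun i => es i.succ)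
        (hes.comp (Fin.succ_injective k)) fun i => hP i.succ)
      (mul_nonneg hβ (hJ _))).trans_eq ?_)
    ring

/-- for any `B ⊆ V` and pairwise distinct edges
`e_1, …, e_k, f_1, …, f_l`,
`∑_{∂n = B, n_{e_i} ≥ 1 ∀i, n_{f_j} = 0 ∀j} w(n)
  ≤ 2^l β^k (∏_i J_{e_i}) (∏_j e^{−βJ_{f_j}}) Z(B Δ e_1 Δ ⋯ Δ e_k)`. -/
theorem statement10 (g1 g2 : E → V) (hloop : ∀ e, g1 e ≠ g2 e)
    (J : E → ℝ) (hJ : ∀ e, 0 ≤ J e) (β : ℝ) (hβ : 0 < β)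
    (B : Finset V) (k l : ℕ) (es : Fin k → E) (fs : Fin l → E)
    (hinj : Function.Injective (Sum.elim es fs)) :
    (∑' n : E → ℕ,
        if curSources g1 g2 n = B ∧ (∀ i, 1 ≤ n (es i)) ∧ (∀ j, n (fs j) = 0)
        then curWeight β J n else 0)
      ≤ 2 ^ l * β ^ k * (∏ i, J (es i)) * (∏ j, Real.exp (-(β * J (fs j)))) *
          curZ g1 g2 β J
            ((List.finRange k).foldl
              (fun F i => symmDiff F {g1 (es i), g2 (es i)}) B) := by
  have hes : Function.Injective es := hinj.comp Sum.inl_injective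
  have hfs : Function.Injective fs := hinj.comp Sum.inr_injective
  have hne : ∀ i j, fs j ≠ es i := fun i j h =>
    Sum.inr_ne_inl (hinj (a₁ := Sum.inr j) (a₂ := Sum.inl i) h)
  refine (tsum_curWeight_forall_one_le_le g1 g2 hβ.le hJ B es hes
    (fun n => ∀ j, n (fs j) = 0) fun i n c => by simp [hne]).trans
      ((mul_le_mul_of_nonneg_left
        (tsum_curWeight_forall_eq_zero_le g1 g2 hβ.le hJ _ fs hfs)
        (mul_nonneg (pow_nonneg hβ.le _) (prod_nonneg fun i _ => hJ _))).trans_eq ?_)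
  ring
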